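/- Let 0 < β < 1, p(n) = n^{−β}, α = min(1/2, β/(2−β)), and let k ≥ 3 be an integer. Then there exists A₀ > 0 such that for every A ≥ A₀, lim_{n→∞} P( (1/2)·E(X_ℓ) ≤ X_ℓ ≤ A·E(X_E)^{⌈ℓ/2⌉−α} for all 3 ≤ ℓ ≤ k ) = 1, where X_ℓ is the number of ℓ-cycles and X_E the number of edges of the Erdős–Rényi random graph G ∈ G(n,p(n)). -/

import Mathlib

open SimpleGraph Finset Filter

namespace SEP

/-- The vector `e_i - e_j` in `ℝ^n`. -/
def eVec {n : ℕ} (i j : Fin n) : Fin n → ℝ :=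
  fun t => (if t = i then 1 else 0) - (if t = j then 1 else 0)

/-- The symmetric edge polytope of a graph on `Fin n`. -/
def symEdgePolytope {n : ℕ} (G : SimpleGraph (Fin n)) : Set (Fin n → ℝ) :=
  convexHull ℝ {x | ∃ i j, G.Adj i j ∧ x = eVec i j}

/-- Both darts `a` and `b` are arcs of a common directed cycle of length `m` of `G`. -/
def dartsInCycle {V : Type*} (G : SimpleGraph V) (a b : G.Dart) (m : ℕ) : Prop :=
  ∃ (u : V) (w : G.Walk u u), w.IsCycle ∧ w.length = m ∧ a ∈ w.darts ∧ b ∈ w.darts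

/-- `F` is a face of the polytope `P`: the set of maximizers of some linear functional. -/
def IsFaceOfPolytope {n : ℕ} (P F : Set (Fin n → ℝ)) : Prop :=
  ∃ a : Fin n → ℝ,
    F = {x | x ∈ P ∧ ∀ y ∈ P, ∑ t, a t * y t ≤ ∑ t, a t * x t}

/-- Dimension of (the affine span of) a subset of `ℝ^n`. -/
noncomputable def polyDim {n : ℕ} (s : Set (Fin n → ℝ)) : ℕ :=
  Module.finrank ℝ (vectorSpan ℝ s)

/-- `v` is a vertex of the polytope `P`. -/
def IsVertexOfPolytope {n : ℕ} (P : Set (Fin n → ℝ)) (v : Fin n → ℝ) : Prop :=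
  IsFaceOfPolytope P {v}

/-- `F` is an edge (a 1-dimensional face) of the polytope `P`. -/
def IsEdgeOfPolytope {n : ℕ} (P F : Set (Fin n → ℝ)) : Prop :=
  IsFaceOfPolytope P F ∧ polyDim F = 1

/-- A polytope is simple if every vertex lies on exactly `dim P` edges. -/
def IsSimplePolytope {n : ℕ} (P : Set (Fin n → ℝ)) : Prop :=
  ∀ v, IsVertexOfPolytope P v →
    Set.ncard {F : Set (Fin n → ℝ) | IsEdgeOfPolytope P F ∧ v ∈ F} = polyDim P

/-- Two disjoint edges, on four vertices. -/
def twoDisjointEdges : SimpleGraph (Fin 4) :=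
  SimpleGraph.fromEdgeSet {s(0, 1), s(2, 3)}

/-- The cyclomatic number `|E| - |V| + c` of a graph, as an integer. -/
noncomputable def cyc {V : Type*} (G : SimpleGraph V) : ℤ :=
  (G.edgeSet.ncard : ℤ) + Nat.card G.ConnectedComponent - Nat.card V

/-- A graph is 2-connected: connected, with at least 3 vertices, and deleting any
single vertex leaves it connected. -/
def TwoConnected {V : Type*} (G : SimpleGraph V) : Prop :=
  G.Connected ∧ 3 ≤ Nat.card V ∧ ∀ v : V, (G.induce {u | u ≠ v}).Connected

/-- The subgraph `H` consists of a single edge of `G`. -/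
def IsSingleEdge {V : Type*} (G : SimpleGraph V) (H : G.Subgraph) : Prop :=
  ∃ (u v : V) (h : G.Adj u v), H = G.subgraphOfAdj h

/-- `H` is a 2-connected component (block) of `G`: an inclusion-maximal subgraph that is
2-connected or a single edge. -/
def IsBlock {V : Type*} (G : SimpleGraph V) (H : G.Subgraph) : Prop :=
  (TwoConnected H.coe ∨ IsSingleEdge G H) ∧
    ∀ H' : G.Subgraph, H ≤ H' → (TwoConnected H'.coe ∨ IsSingleEdge G H') → H' = H

/-- A pair of darts (oriented edges) of `G`, with distinct underlying edges, is *bad*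
with respect to the order `elt` on edges. -/
def BadPair {V : Type*} (G : SimpleGraph V) (elt : Sym2 V → Sym2 V → Prop)
    (a b : G.Dart) : Prop :=
  a.edge ≠ b.edge ∧
    (dartsInCycle G a b 3 ∨
      ∃ (u : V) (w : G.Walk u u), w.IsCycle ∧ w.length = 4 ∧ a ∈ w.darts ∧ b ∈ w.darts ∧
        (∃ e ∈ w.edges, elt e a.edge) ∧ (∃ e ∈ w.edges, elt e b.edge))

/-- `n₁(G, <)`: the number of (unordered) bad pairs of oriented edges. -/
noncomputable def n1 {V : Type*} (G : SimpleGraph V) (elt : Sym2 V → Sym2 V → Prop) : ℕ :=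
  Set.ncard {z : Sym2 G.Dart | ∃ a b, BadPair G elt a b ∧ z = s(a, b)}

/-- `γ₂(G, <) = 2 cy(G)(cy(G)+2) - n₁(G, <)`. -/
noncomputable def gammaTwo {V : Type*} (G : SimpleGraph V)
    (elt : Sym2 V → Sym2 V → Prop) : ℤ :=
  2 * cyc G * (cyc G + 2) - (n1 G elt : ℤ)

/-- Restriction of an order on `Sym2 V` to `Sym2 s` for `s : Set V`. -/
def restrictOrd {V : Type*} (elt : Sym2 V → Sym2 V → Prop) (s : Set V) :
    Sym2 s → Sym2 s → Prop :=
  fun e₁ e₂ => elt (e₁.map Subtype.val) (e₂.map Subtype.val)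

/-- The graph `G_n` on `Fin n`: vertices `0` and `1` are adjacent to everything. -/
def GnGraph (n : ℕ) : SimpleGraph (Fin n) :=
  SimpleGraph.fromRel (fun a _ => a.val < 2)

/-- The complete bipartite graph `K_{2, n-2}` on `Fin n`, with parts `{0,1}` and the rest. -/
def K2Graph (n : ℕ) : SimpleGraph (Fin n) :=
  SimpleGraph.fromRel (fun a b => a.val < 2 ∧ 2 ≤ b.val)

/-- A set `S` of darts of `G` is a face of the triangulation `Δ_<` of `∂P_G`. -/
def IsFace {V : Type*} (G : SimpleGraph V) (elt : Sym2 V → Sym2 V → Prop)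
    (S : Set G.Dart) : Prop :=
  (¬ ∃ d ∈ S, d.symm ∈ S) ∧
    ∀ ℓ : ℕ, 2 ≤ ℓ → ∀ (u : V) (w : G.Walk u u), w.IsCycle →
      (w.length = 2 * ℓ - 1 → Set.ncard {d ∈ S | d ∈ w.darts} < ℓ) ∧
      (w.length = 2 * ℓ →
        Set.ncard {d ∈ S | d ∈ w.darts ∧ ∃ e ∈ w.edges, elt e d.edge} < ℓ)

/-- The face complex `Δ_<` of `(G, <)`. -/
def faceCx {V : Type*} (G : SimpleGraph V) (elt : Sym2 V → Sym2 V → Prop) :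
    Set (Set G.Dart) :=
  {S | IsFace G elt S}

/-- The join of two simplicial complexes (given as families of faces on disjoint
vertex types). -/
def joinCx {A B : Type*} (F : Set (Set A)) (H : Set (Set B)) : Set (Set (A ⊕ B)) :=
  {S | ∃ F₁ ∈ F, ∃ H₁ ∈ H, S = Sum.inl '' F₁ ∪ Sum.inr '' H₁}

/-- The complex consisting of two disjoint vertices. -/
def twoPtCx : Set (Set (Fin 2)) :=
  {S | S = ∅ ∨ S = {0} ∨ S = {1}}

/-- Contraction of the edge `{v, w}` of a simplicial complex; `v` is identified with `w`. -/
def contractCx {A : Type*} (F : Set (Set A)) (v w : A) : Set (Set A) :=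
  {S | (S ∈ F ∧ v ∉ S) ∨ ∃ H ∈ F, v ∈ H ∧ S = (H \ {v}) ∪ {w}}

/-- Isomorphism of simplicial complexes: a bijection of vertex sets inducing a bijection
of faces. -/
def CxIso {A B : Type*} (F : Set (Set A)) (H : Set (Set B)) : Prop :=
  ∃ φ : A → B, Set.BijOn φ (⋃₀ F) (⋃₀ H) ∧
    (∀ S ∈ F, φ '' S ∈ H) ∧ (∀ T ∈ H, ∃ S ∈ F, φ '' S = T)

/-! ### Erdős–Rényi random graphs -/

/-- The probability weight of a fixed graph `G` in the Erdős–Rényi model `G(n,p)`. -/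
noncomputable def graphWeight (n : ℕ) (p : ℝ) (G : SimpleGraph (Fin n)) : ℝ :=
  p ^ G.edgeSet.ncard * (1 - p) ^ (n.choose 2 - G.edgeSet.ncard)

/-- The probability of an event `A` in the Erdős–Rényi model `G(n,p)`. -/
noncomputable def erProb (n : ℕ) (p : ℝ) (A : Set (SimpleGraph (Fin n))) : ℝ :=
  ∑ G : SimpleGraph (Fin n), A.indicator (graphWeight n p) G

/-- The expectation of a random variable in the Erdős–Rényi model `G(n,p)`. -/
noncomputable def erExp (n : ℕ) (p : ℝ) (X : SimpleGraph (Fin n) → ℝ) : ℝ :=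
  ∑ G : SimpleGraph (Fin n), graphWeight n p G * X G

/-- The variance of a random variable in the Erdős–Rényi model `G(n,p)`. -/
noncomputable def erVar (n : ℕ) (p : ℝ) (X : SimpleGraph (Fin n) → ℝ) : ℝ :=
  erExp n p (fun G => (X G - erExp n p X) ^ 2)

/-- The number of cycles of `G` with exactly `k` vertices, counted via their edge sets. -/
noncomputable def numCycles {V : Type*} (G : SimpleGraph V) (k : ℕ) : ℕ :=
  Set.ncard {s : Set (Sym2 V) |
    ∃ (u : V) (w : G.Walk u u), w.IsCycle ∧ w.length = k ∧ s = {e | e ∈ w.edges}}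

/-- `E(X_k) = C(n,k)·((k−1)!/2)·p^k`, the expected number of `k`-cycles. -/
noncomputable def expCycles (n : ℕ) (p : ℝ) (k : ℕ) : ℝ :=
  (n.choose k : ℝ) * ((Nat.factorial (k - 1) : ℝ) / 2) * p ^ k

/-- `E(X_E) = C(n,2)·p`, the expected number of edges. -/
noncomputable def expEdges (n : ℕ) (p : ℝ) : ℝ :=
  (n.choose 2 : ℝ) * p

/-- `n_{k-1}(G)`: the number of `k`-element non-faces of `Δ_<` containing no antipodal
pair. -/
noncomputable def numNonFaces {V : Type*} (G : SimpleGraph V)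
    (elt : Sym2 V → Sym2 V → Prop) (k : ℕ) : ℕ :=
  Set.ncard {S : Set G.Dart |
    S.ncard = k ∧ (¬ ∃ d ∈ S, d.symm ∈ S) ∧ ¬ IsFace G elt S}

/-- `f_{k-1}(G)`: the number of `k`-element faces of `Δ_<`. -/
noncomputable def numFaces {V : Type*} (G : SimpleGraph V)
    (elt : Sym2 V → Sym2 V → Prop) (k : ℕ) : ℕ :=
  Set.ncard {S : Set G.Dart | S.ncard = k ∧ IsFace G elt S}

/-- The generalized binomial coefficient `binom(x, ℓ)` for real `x`. -/
noncomputable def realChoose (x : ℝ) (ℓ : ℕ) : ℝ :=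
  (∏ i ∈ Finset.range ℓ, (x - i)) / (Nat.factorial ℓ)

/-- The recursively defined γ-numbers `γ_ℓ(G)`:
`γ_0 = 1` and
`γ_ℓ = f_{ℓ−1} − [t^{n−1−ℓ}] ∑_{i<ℓ} γ_i (t+1)^i (t+2)^{n−1−2i}`. -/
noncomputable def gammaRG (n : ℕ) (G : SimpleGraph (Fin n))
    (elt : Sym2 (Fin n) → Sym2 (Fin n) → Prop) : ℕ → ℤ := fun ℓ =>
  Nat.strongRecOn ℓ (fun ℓ ih =>
    if ℓ = 0 then (1 : ℤ)
    else
      (numFaces G elt ℓ : ℤ) -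
        Polynomial.coeff
          (∑ i ∈ (Finset.range ℓ).attach,
            Polynomial.C (ih i.1 (Finset.mem_range.mp i.2)) *
              ((Polynomial.X + 1) ^ (i.1 : ℕ) *
                (Polynomial.X + 2) ^ (n - 1 - 2 * i.1) : Polynomial ℤ))
          (n - 1 - ℓ))

theorem graphWeight_nonneg {n : ℕ} {p : ℝ} (hp0 : 0 ≤ p) (hp1 : p ≤ 1)
    (G : SimpleGraph (Fin n)) : 0 ≤ graphWeight n p G :=
  mul_nonneg (pow_nonneg hp0 _) (pow_nonneg (sub_nonneg.2 hp1) _)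

open Classical in
/-- A prescribed set of `#S` potential edges is present with probability `p ^ #S`. -/
theorem erExp_subset_edgeSet (n : ℕ) (p : ℝ) (S : Finset (Sym2 (Fin n)))
    (hS : ∀ e ∈ S, ¬ e.IsDiag) :
    erExp n p (fun G => if (S : Set (Sym2 (Fin n))) ⊆ G.edgeSet then 1 else 0) = p ^ #S := by
  set U : Finset (Sym2 (Fin n)) := (⊤ : SimpleGraph (Fin n)).edgeFinset with hU
  have hUcard : #U = n.choose 2 := by
    rw [hU, card_edgeFinset_top_eq_card_choose_two, Fintype.card_fin]
  have hmemU : ∀ e, e ∈ U ↔ ¬ e.IsDiag := fun e => by simp [hU]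
  have hSU : S ⊆ U := fun e he => (hmemU e).2 (hS e he)
  have key : ∑ T ∈ (U \ S).powerset, p ^ #S * (p ^ #T * (1 - p) ^ (#(U \ S) - #T)) = p ^ #S := by
    rw [← Finset.mul_sum, Finset.sum_pow_mul_eq_add_pow]
    simp
  rw [← key, erExp]
  simp only [mul_ite, mul_one, mul_zero]
  rw [← Finset.sum_filter]
  refine Finset.sum_bij' (fun G _ => G.edgeFinset \ S)
    (fun T _ => SimpleGraph.fromEdgeSet ((T ∪ S : Finset (Sym2 (Fin n))) : Set (Sym2 (Fin n))))
    ?_ ?_ ?_ ?_ ?_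
  · intro G hG
    rw [Finset.mem_powerset]
    intro e he
    rw [Finset.mem_sdiff] at he ⊢
    refine ⟨(hmemU e).2 ?_, he.2⟩
    exact G.not_isDiag_of_mem_edgeSet (by simpa using he.1)
  · intro T hT
    simp only [Finset.mem_filter, Finset.mem_univ, true_and]
    intro e he
    rw [edgeSet_fromEdgeSet]
    exact ⟨by simp_all, hS e he⟩
  · intro G hG
    simp only [Finset.mem_filter, Finset.mem_univ, true_and] at hG
    have : ((G.edgeFinset \ S ∪ S : Finset (Sym2 (Fin n))) : Set (Sym2 (Fin n))) = G.edgeSet := by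
      push_cast
      rw [Set.sdiff_union_of_subset hG]
    rw [this, fromEdgeSet_edgeSet]
  · intro T hT
    rw [Finset.mem_powerset] at hT
    ext e
    simp only [Finset.mem_sdiff, mem_edgeFinset, edgeSet_fromEdgeSet, Set.mem_sdiff,
      Finset.mem_coe, Finset.mem_union]
    constructor
    · tauto
    · intro he
      have := Finset.mem_sdiff.1 (hT he)
      exact ⟨⟨Or.inl he, (hmemU e).1 this.1⟩, this.2⟩
  · intro G hG
    simp only [Finset.mem_filter, Finset.mem_univ, true_and] at hG
    have hSG : S ⊆ G.edgeFinset := fun e he => by simpa using hG he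
    have h1 : G.edgeSet.ncard = #(G.edgeFinset) := by
      rw [← coe_edgeFinset, Set.ncard_coe_finset]
    have h2 := Finset.card_sdiff_add_card_eq_card hSG
    have h3 := Finset.card_sdiff_add_card_eq_card hSU
    rw [graphWeight, h1, ← hUcard, ← mul_assoc, ← pow_add]
    congr 2 <;> omega

theorem sum_graphWeight (n : ℕ) (p : ℝ) :
    ∑ G : SimpleGraph (Fin n), graphWeight n p G = 1 := by
  simpa [erExp] using erExp_subset_edgeSet n p ∅ (by simp)

theorem erProb_eq_one_sub_compl (n : ℕ) (p : ℝ) (B : Set (SimpleGraph (Fin n))) :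
    erProb n p B = 1 - erProb n p Bᶜ := by
  rw [eq_sub_iff_add_eq, ← sum_graphWeight n p, erProb, erProb, ← Finset.sum_add_distrib]
  exact Finset.sum_congr rfl fun G _ => Set.indicator_self_add_compl_apply B _ G

theorem erProb_nonneg {n : ℕ} {p : ℝ} (hp0 : 0 ≤ p) (hp1 : p ≤ 1)
    (B : Set (SimpleGraph (Fin n))) : 0 ≤ erProb n p B :=
  Finset.sum_nonneg fun _ _ => Set.indicator_nonneg (fun _ _ => graphWeight_nonneg hp0 hp1 _) _

/-- Markov's inequality in `G(n,p)`. -/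
theorem erProb_le_of_one_le {n : ℕ} {p : ℝ} (hp0 : 0 ≤ p) (hp1 : p ≤ 1)
    {B : Set (SimpleGraph (Fin n))} {X : SimpleGraph (Fin n) → ℝ} (hX : ∀ G, 0 ≤ X G)
    (hB : ∀ G ∈ B, 1 ≤ X G) : erProb n p B ≤ erExp n p X := by
  refine Finset.sum_le_sum fun G _ => ?_
  have hw := graphWeight_nonneg hp0 hp1 G
  by_cases h : G ∈ B
  · rw [Set.indicator_of_mem h]
    nlinarith [hB G h]
  · rw [Set.indicator_of_notMem h]
    exact mul_nonneg hw (hX G)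

theorem erExp_sum {n : ℕ} {p : ℝ} {ι : Type*} (s : Finset ι)
    (X : ι → SimpleGraph (Fin n) → ℝ) :
    erExp n p (fun G => ∑ i ∈ s, X i G) = ∑ i ∈ s, erExp n p (X i) := by
  simp only [erExp, Finset.mul_sum]
  exact Finset.sum_comm

theorem erExp_const_mul {n : ℕ} {p : ℝ} (c : ℝ) (X : SimpleGraph (Fin n) → ℝ) :
    erExp n p (fun G => c * X G) = c * erExp n p X := by
  simp only [erExp, Finset.mul_sum]
  exact Finset.sum_congr rfl fun _ _ => by ring

theorem erVar_eq {n : ℕ} {p : ℝ} (X : SimpleGraph (Fin n) → ℝ) :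
    erVar n p X = erExp n p (fun G => X G ^ 2) - erExp n p X ^ 2 := by
  rw [erVar]
  set μ := erExp n p X with hμ
  have : ∀ G, graphWeight n p G * (X G - μ) ^ 2 =
      graphWeight n p G * X G ^ 2 - 2 * μ * (graphWeight n p G * X G)
        + μ ^ 2 * graphWeight n p G := fun G => by ring
  simp only [erExp, this, Finset.sum_add_distrib, Finset.sum_sub_distrib, ← Finset.mul_sum,
    sum_graphWeight]
  rw [← erExp.eq_1 n p X, ← hμ]
  ring

/-- Chebyshev's inequality in `G(n,p)`, for the lower tail at half the mean. -/
theorem erProb_lt_half_le {n : ℕ} {p : ℝ} (hp0 : 0 ≤ p) (hp1 : p ≤ 1)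
    (X : SimpleGraph (Fin n) → ℝ) (hpos : 0 < erExp n p X) :
    erProb n p {G | X G < erExp n p X / 2} ≤ 4 * erVar n p X / erExp n p X ^ 2 := by
  set μ := erExp n p X with hμ
  have := erProb_le_of_one_le (n := n) hp0 hp1 (B := {G | X G < μ / 2})
    (X := fun G => 4 / μ ^ 2 * (X G - μ) ^ 2) (fun G => by positivity) (fun G hG => by
      simp only [Set.mem_ofPred_eq] at hG
      rw [div_mul_eq_mul_div, one_le_div (by positivity)]
      nlinarith)
  rw [erExp_const_mul] at this
  refine this.trans_eq ?_
  rw [erVar]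
  ring

/-- The edges `{f i, f (i + 1)}` of the closed sequence of vertices `f`. -/
def cycleEdges {V : Type*} [DecidableEq V] {m : ℕ} (f : Fin (m + 3) → V) : Finset (Sym2 V) :=
  univ.image fun i => s(f i, f (i + 1))

theorem fin_add_one_add_one_ne {m : ℕ} (i : Fin (m + 3)) : i + 1 + 1 ≠ i := by
  rw [add_assoc, ne_eq, add_eq_left, Fin.ext_iff]
  simp [Fin.val_add, Nat.mod_eq_of_lt]

theorem fin_add_one_ne {m : ℕ} (i : Fin (m + 3)) : i + 1 ≠ i := by
  rw [ne_eq, add_eq_left, Fin.ext_iff]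
  simp

theorem injective_cycleEdge {V : Type*} {m : ℕ} {f : Fin (m + 3) → V} (hf : Function.Injective f) :
    Function.Injective fun i => s(f i, f (i + 1)) := by
  intro i j hij
  simp only [Sym2.eq_iff, hf.eq_iff] at hij
  obtain h | ⟨h1, h2⟩ := hij
  · exact h.1
  · subst h1
    exact absurd h2 (fin_add_one_add_one_ne j)

section cycleEdges

variable {V : Type*} [DecidableEq V] {m : ℕ}

theorem mem_cycleEdges {f : Fin (m + 3) → V} {e : Sym2 V} :
    e ∈ cycleEdges f ↔ ∃ i, s(f i, f (i + 1)) = e := by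
  simp [cycleEdges]

theorem not_isDiag_of_mem_cycleEdges {f : Fin (m + 3) → V} (hf : Function.Injective f)
    {e : Sym2 V} (he : e ∈ cycleEdges f) : ¬ e.IsDiag := by
  obtain ⟨i, rfl⟩ := mem_cycleEdges.1 he
  rw [Sym2.mk_isDiag_iff]
  exact fun h => fin_add_one_ne i (hf h).symm

theorem card_cycleEdges {f : Fin (m + 3) → V} (hf : Function.Injective f) :
    #(cycleEdges f) = m + 3 := by
  rw [cycleEdges, Finset.card_image_of_injective _ (injective_cycleEdge hf), Finset.card_univ,
    Fintype.card_fin]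

/-- A cyclic sequence is determined by its edge set and its first two vertices. -/
theorem eq_of_cycleEdges_eq {f g : Fin (m + 3) → V} (hf : Function.Injective f)
    (hg : Function.Injective g) (h : cycleEdges f = cycleEdges g) (h0 : f 0 = g 0)
    (h1 : f 1 = g 1) : f = g := by
  have step : ∀ i, f i = g i → f (i + 1) = g (i + 1) → f (i + 1 + 1) = g (i + 1 + 1) := by
    intro i hi hi1
    have : s(f (i + 1), f (i + 1 + 1)) ∈ cycleEdges g := h ▸ mem_cycleEdges.2 ⟨i + 1, rfl⟩
    obtain ⟨j, hj⟩ := mem_cycleEdges.1 this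
    rw [hi1, Sym2.eq_iff] at hj
    obtain ⟨ha, hb⟩ | ⟨ha, hb⟩ := hj
    · rw [← hb, hg ha]
    · have hji : j = i := add_right_cancel (hg hb)
      rw [hji, ← hi] at ha
      exact absurd (hf ha).symm (fin_add_one_add_one_ne i)
  have key : ∀ i, f i = g i ∧ f (i + 1) = g (i + 1) := by
    intro i
    induction i using Fin.induction with
    | zero => simpa using ⟨h0, h1⟩
    | succ t ih =>
      rw [← Fin.coeSucc_eq_succ]
      exact ⟨ih.2, step _ ih.1 ih.2⟩
  exact funext fun i => (key i).1

/-- An `ℓ`-cycle is traced by at most `2ℓ` injective cyclic sequences. -/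
theorem card_filter_cycleEdges_eq_le [Fintype V] (S : Finset (Sym2 V)) :
    #{f : Fin (m + 3) ↪ V | cycleEdges f = S} ≤ 2 * (m + 3) := by
  by_cases hne : ∃ f : Fin (m + 3) ↪ V, cycleEdges f = S
  · obtain ⟨f, rfl⟩ := hne
    have hsub : ({g : Fin (m + 3) ↪ V | cycleEdges g = cycleEdges f} : Finset _).image
        (fun g => (g 0, g 1)) ⊆
        univ.image (fun i => (f i, f (i + 1))) ∪ univ.image (fun i => (f (i + 1), f i)) := by
      intro x hx
      simp only [Finset.mem_image, Finset.mem_filter, Finset.mem_univ, true_and] at hx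
      obtain ⟨g, hg, rfl⟩ := hx
      have : s(g 0, g 1) ∈ cycleEdges f := hg ▸ mem_cycleEdges.2 ⟨0, by simp⟩
      obtain ⟨i, hi⟩ := mem_cycleEdges.1 this
      rw [Sym2.eq_iff] at hi
      simp only [Finset.mem_union, Finset.mem_image, Finset.mem_univ, true_and, Prod.mk.injEq]
      obtain hi | hi := hi
      · exact Or.inl ⟨i, hi⟩
      · exact Or.inr ⟨i, hi.symm⟩
    rw [← Finset.card_image_of_injOn (f := fun g : Fin (m + 3) ↪ V => (g 0, g 1))]
    · refine (Finset.card_le_card hsub).trans ((Finset.card_union_le _ _).trans ?_)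
      rw [two_mul]
      exact add_le_add (Finset.card_image_le.trans (by simp))
        (Finset.card_image_le.trans (by simp))
    · intro g hg g' hg' h
      simp only [Finset.coe_filter, Finset.mem_univ, true_and, Set.mem_ofPred_eq] at hg hg'
      simp only [Prod.mk.injEq] at h
      exact DFunLike.coe_injective
        (eq_of_cycleEdges_eq g.injective g'.injective (hg.trans hg'.symm) h.1 h.2)
  · rw [Finset.filter_false_of_mem fun f _ hf => hne ⟨f, hf⟩]
    simp

theorem exists_isCycle_iff_exists_embedding (G : SimpleGraph V) (s : Set (Sym2 V)) :
    (∃ (u : V) (w : G.Walk u u), w.IsCycle ∧ w.length = m + 3 ∧ s = {e | e ∈ w.edges}) ↔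
      ∃ f : Fin (m + 3) ↪ V, (cycleEdges f : Set (Sym2 V)) ⊆ G.edgeSet ∧ s = cycleEdges f := by
  constructor
  · rintro ⟨u, w, hw, hl, rfl⟩
    have hinj : Function.Injective fun i : Fin (m + 3) => w.getVert i := fun i j hij =>
      Fin.ext (hw.getVert_injOn' (by simp only [Set.mem_ofPred_eq]; omega)
        (by simp only [Set.mem_ofPred_eq]; omega) hij)
    have hsucc : ∀ i : Fin (m + 3), w.getVert (i + 1 : Fin (m + 3)) = w.getVert (i + 1) := by
      intro i
      rw [Fin.val_add_one]
      split_ifs with h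
      · have : (i : ℕ) + 1 = w.length := by rw [hl, h]; simp
        rw [this, w.getVert_length, w.getVert_zero]
      · rfl
    have hE : {e | e ∈ w.edges} = (cycleEdges (fun i : Fin (m + 3) => w.getVert i) : Set _) := by
      ext e
      induction e using Sym2.ind with
      | _ a b =>
        rw [Set.mem_ofPred_eq, w.mk_mem_edges_iff_exists, Finset.mem_coe, mem_cycleEdges]
        simp only [hsucc, hl]
        exact ⟨fun ⟨i, hi, h⟩ => ⟨⟨i, hi⟩, h⟩, fun ⟨i, h⟩ => ⟨i, i.2, h⟩⟩
    refine ⟨⟨_, hinj⟩, ?_, hE⟩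
    rw [Function.Embedding.coeFn_mk, ← hE]
    exact fun e he => w.edges_subset_edgeSet he
  · rintro ⟨f, hf, rfl⟩
    have hadj : ∀ i, G.Adj (f i) (f (i + 1)) := fun i => hf (mem_cycleEdges.2 ⟨i, rfl⟩)
    let φ : cycleGraph (m + 3) →g G := ⟨f, by
      intro a b hab
      rw [cycleGraph_adj] at hab
      obtain h | h := hab
      · rw [sub_eq_iff_eq_add'] at h
        subst h
        simpa [add_comm] using (hadj b).symm
      · rw [sub_eq_iff_eq_add'] at h
        subst h
        simpa [add_comm] using hadj a⟩
    have hφ : ∀ i, φ i = f i := fun _ => rfl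
    refine ⟨φ 0, (cycleGraph.cycle m).map φ, ?_, ?_, ?_⟩
    · exact (Walk.isCycle_map_iff_of_injective f.injective).2 cycleGraph.isCycle_cycle
    · rw [Walk.length_map, cycleGraph.length_cycle]
    · ext e
      induction e using Sym2.ind with
      | _ a b =>
        rw [Set.mem_ofPred_eq, Walk.mk_mem_edges_iff_exists, Finset.mem_coe, mem_cycleEdges,
          Walk.length_map, cycleGraph.length_cycle]
        have hv : ∀ i : Fin (m + 3), (cycleGraph.cycle m).getVert (m + 3 - (i + 1)) = i + 1 ∧
            (cycleGraph.cycle m).getVert (m + 3 - (i + 1) + 1) = i := by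
          intro i
          constructor
          · rw [cycleGraph.getVert_cycle (by omega)]
            ext
            simp only [Fin.val_add, Fin.val_one]
            congr 1
            omega
          · rw [cycleGraph.getVert_cycle (by omega)]
            ext
            simp only
            rw [show m + 3 - (m + 3 - ((i : ℕ) + 1) + 1) = i by omega, Nat.mod_eq_of_lt i.2]
        constructor
        · rintro ⟨i, hi⟩
          refine ⟨m + 3 - (i + 1), by omega, ?_⟩
          rw [Walk.getVert_map, Walk.getVert_map, (hv i).1, (hv i).2, hφ, hφ, Sym2.eq_swap, hi]
        · rintro ⟨j, hj, h⟩
          refine ⟨⟨m + 3 - (j + 1), by omega⟩, ?_⟩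
          have := hv ⟨m + 3 - (j + 1), by omega⟩
          simp only [show m + 3 - (m + 3 - (j + 1) + 1) = j by omega] at this
          rw [Walk.getVert_map, Walk.getVert_map, this.1, this.2, hφ, hφ, Sym2.eq_swap] at h
          exact h

theorem numCycles_eq_card [Fintype V] (G : SimpleGraph V) [DecidableRel G.Adj] :
    numCycles G (m + 3) =
      #(({f : Fin (m + 3) ↪ V | cycleEdges f ⊆ G.edgeFinset} : Finset _).image
        fun f : Fin (m + 3) ↪ V => cycleEdges f) := by
  have hinj : Function.Injective fun s : Finset (Sym2 V) => (s : Set (Sym2 V)) :=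
    Finset.coe_injective
  rw [numCycles, ← Set.ncard_coe_finset, ← Set.ncard_image_of_injective _ hinj]
  congr 1
  ext s
  rw [Set.mem_ofPred_eq, exists_isCycle_iff_exists_embedding]
  simp [← Finset.coe_subset, eq_comm]

theorem numCycles_le_card [Fintype V] (G : SimpleGraph V) [DecidableRel G.Adj] :
    numCycles G (m + 3) ≤ #{f : Fin (m + 3) ↪ V | cycleEdges f ⊆ G.edgeFinset} := by
  rw [numCycles_eq_card]
  exact Finset.card_image_le

theorem card_le_mul_numCycles [Fintype V] (G : SimpleGraph V) [DecidableRel G.Adj] :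
    #{f : Fin (m + 3) ↪ V | cycleEdges f ⊆ G.edgeFinset} ≤
      2 * (m + 3) * numCycles G (m + 3) := by
  rw [numCycles_eq_card]
  refine Finset.card_le_mul_card_image _ _ fun S _ => (Finset.card_le_card ?_).trans
    (card_filter_cycleEdges_eq_le S)
  exact Finset.filter_subset_filter _ (Finset.subset_univ _)

end cycleEdges

open Classical in
/-- The number of injective cyclic sequences of length `m + 3` tracing a cycle of `G`. -/
noncomputable def cycleCopies (m : ℕ) {n : ℕ} (G : SimpleGraph (Fin n)) : ℝ :=
  ∑ f : Fin (m + 3) ↪ Fin n, if (cycleEdges f : Set (Sym2 (Fin n))) ⊆ G.edgeSet then 1 else 0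

open Classical in
theorem cycleCopies_eq_card (m : ℕ) {n : ℕ} (G : SimpleGraph (Fin n)) :
    cycleCopies m G = #{f : Fin (m + 3) ↪ Fin n | cycleEdges f ⊆ G.edgeFinset} := by
  rw [cycleCopies, Finset.sum_boole]
  congr 3
  ext f
  rw [← Finset.coe_subset, coe_edgeFinset]

theorem cycleCopies_nonneg (m : ℕ) {n : ℕ} (G : SimpleGraph (Fin n)) : 0 ≤ cycleCopies m G :=
  Finset.sum_nonneg fun _ _ => by split_ifs <;> norm_num

theorem numCycles_le_cycleCopies (m : ℕ) {n : ℕ} (G : SimpleGraph (Fin n)) :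
    (numCycles G (m + 3) : ℝ) ≤ cycleCopies m G := by
  classical
  rw [cycleCopies_eq_card]
  exact_mod_cast numCycles_le_card G

theorem cycleCopies_le_mul_numCycles (m : ℕ) {n : ℕ} (G : SimpleGraph (Fin n)) :
    cycleCopies m G ≤ 2 * (m + 3 : ℕ) * numCycles G (m + 3) := by
  classical
  rw [cycleCopies_eq_card]
  exact_mod_cast card_le_mul_numCycles G

theorem erExp_cycleCopies (m n : ℕ) (p : ℝ) :
    erExp n p (cycleCopies m) = n.descFactorial (m + 3) * p ^ (m + 3) := by
  classical
  rw [show (cycleCopies m : SimpleGraph (Fin n) → ℝ) = fun G => cycleCopies m G from rfl]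
  simp only [cycleCopies]
  rw [erExp_sum, Finset.sum_congr rfl fun (f : Fin (m + 3) ↪ Fin n) _ =>
    erExp_subset_edgeSet n p (cycleEdges f) fun e he =>
      not_isDiag_of_mem_cycleEdges f.injective he]
  simp [card_cycleEdges (Function.Embedding.injective _), Fintype.card_embedding_eq]

theorem erExp_cycleCopies_sq (m n : ℕ) (p : ℝ) :
    erExp n p (fun G => cycleCopies m G ^ 2) =
      ∑ f : Fin (m + 3) ↪ Fin n, ∑ g : Fin (m + 3) ↪ Fin n,
        p ^ #(cycleEdges f ∪ cycleEdges g) := by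
  classical
  have h : ∀ G : SimpleGraph (Fin n), cycleCopies m G ^ 2 =
      ∑ f : Fin (m + 3) ↪ Fin n, ∑ g : Fin (m + 3) ↪ Fin n,
        if ((cycleEdges f ∪ cycleEdges g : Finset _) : Set (Sym2 (Fin n))) ⊆ G.edgeSet
          then 1 else 0 := by
    intro G
    rw [cycleCopies, sq, Finset.sum_mul_sum]
    refine Finset.sum_congr rfl fun f _ => Finset.sum_congr rfl fun g _ => ?_
    rw [Finset.coe_union]
    simp only [Set.union_subset_iff]
    split_ifs <;> simp_all
  simp only [h]
  rw [erExp_sum]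
  refine Finset.sum_congr rfl fun f _ => ?_
  rw [erExp_sum]
  refine Finset.sum_congr rfl fun g _ => erExp_subset_edgeSet n p _ fun e he => ?_
  obtain he | he := Finset.mem_union.1 he
  · exact not_isDiag_of_mem_cycleEdges f.injective he
  · exact not_isDiag_of_mem_cycleEdges g.injective he

/-- Two cycles share at most as many edges as vertices. -/
theorem card_inter_cycleEdges_le {V : Type*} [DecidableEq V] {m : ℕ} (f g : Fin (m + 3) → V) :
    #(cycleEdges f ∩ cycleEdges g) ≤ #{j | g j ∈ univ.image f} := by
  refine (Finset.card_le_card (t := ({j | g j ∈ univ.image f} : Finset _).image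
    fun j => s(g j, g (j + 1))) fun e he => ?_).trans Finset.card_image_le
  rw [Finset.mem_inter] at he
  obtain ⟨j, rfl⟩ := mem_cycleEdges.1 he.2
  obtain ⟨i, hi⟩ := mem_cycleEdges.1 he.1
  refine Finset.mem_image.2 ⟨j, ?_, rfl⟩
  rw [Sym2.eq_iff] at hi
  simp only [Finset.mem_filter, Finset.mem_univ, true_and, Finset.mem_image]
  obtain hi | hi := hi
  · exact ⟨_, hi.1⟩
  · exact ⟨_, hi.2⟩

theorem pow_card_union_cycleEdges_le {V : Type*} [DecidableEq V] {m : ℕ} {p : ℝ} (hp0 : 0 ≤ p)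
    (hp1 : p ≤ 1) (f g : Fin (m + 3) ↪ V) :
    p ^ #(cycleEdges f ∪ cycleEdges g) ≤ p ^ (2 * (m + 3)) +
      ∑ J : Finset (Fin (m + 3)) with J.Nonempty,
        if ∀ j ∈ J, g j ∈ univ.image f then p ^ (2 * (m + 3) - #J) else 0 := by
  have hsum := Finset.card_union_add_card_inter (cycleEdges f) (cycleEdges g)
  rw [card_cycleEdges f.injective, card_cycleEdges g.injective] at hsum
  have hle := card_inter_cycleEdges_le f g
  set J : Finset (Fin (m + 3)) := {j | g j ∈ univ.image f} with hJ
  have hnn : ∀ J : Finset (Fin (m + 3)),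
      0 ≤ if ∀ j ∈ J, g j ∈ univ.image f then p ^ (2 * (m + 3) - #J) else 0 :=
    fun J => by split_ifs <;> positivity
  by_cases hne : J.Nonempty
  · refine le_trans ?_ (le_add_of_nonneg_left (by positivity))
    refine le_trans ?_ (Finset.single_le_sum (fun J _ => hnn J) (a := J) (by simpa using hne))
    rw [if_pos fun j hj => (Finset.mem_filter.1 hj).2]
    exact pow_le_pow_of_le_one hp0 hp1 (by omega)
  · rw [Finset.not_nonempty_iff_eq_empty] at hne
    rw [hne, Finset.card_empty] at hle
    rw [show #(cycleEdges f ∪ cycleEdges g) = 2 * (m + 3) by omega]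
    exact le_add_of_nonneg_right (Finset.sum_nonneg fun J _ => hnn J)

theorem card_embedding_mem_le {l n : ℕ} (T : Finset (Fin n)) (J : Finset (Fin l)) :
    #{g : Fin l ↪ Fin n | ∀ j ∈ J, g j ∈ T} ≤ #T ^ #J * n ^ (l - #J) := by
  classical
  have hcard : #(Fintype.piFinset fun j => if j ∈ J then T else univ) =
      #T ^ #J * n ^ (l - #J) := by
    rw [Fintype.card_piFinset]
    simp only [apply_ite Finset.card]
    rw [Finset.prod_ite]
    simp [Finset.filter_not, Finset.card_sdiff]
  rw [← hcard]
  refine Finset.card_le_card_of_injOn (fun g => g) (fun g hg => ?_)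
    DFunLike.coe_injective.injOn
  simp only [Finset.coe_filter, Finset.mem_univ, true_and, Set.mem_ofPred_eq] at hg
  simp only [Finset.mem_coe, Fintype.mem_piFinset]
  intro j
  split_ifs with h
  · exact hg j h
  · exact Finset.mem_univ _

theorem erVar_cycleCopies_le {m n : ℕ} {p : ℝ} (hp0 : 0 ≤ p) (hp1 : p ≤ 1) (hnp : 1 ≤ n * p) :
    erVar n p (cycleCopies m) ≤
      (2 * (m + 3 : ℕ)) ^ (m + 3) * (n * p) ^ (2 * (m + 3) - 1) := by
  classical
  set l := m + 3 with hl
  have hl1 : (1 : ℝ) ≤ l := by rw [hl]; push_cast; linarith [(Nat.cast_nonneg m : (0 : ℝ) ≤ m)]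
  have hcardE : (Fintype.card (Fin l ↪ Fin n) : ℝ) = n.descFactorial l := by
    simp [Fintype.card_embedding_eq]
  have hterm : ∀ (f : Fin l ↪ Fin n) (J : Finset (Fin l)), J.Nonempty →
      (∑ g : Fin l ↪ Fin n, if ∀ j ∈ J, g j ∈ univ.image f then p ^ (2 * l - #J) else 0) ≤
        (l : ℝ) ^ l * (p ^ l * (n * p) ^ (l - 1)) := by
    intro f J hJ
    have hJl : #J ≤ l := (Finset.card_le_univ J).trans_eq (Fintype.card_fin l)
    have hJ1 : 1 ≤ #J := hJ.card_pos
    rw [← Finset.sum_filter, Finset.sum_const, nsmul_eq_mul]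
    have hc : (#{g : Fin l ↪ Fin n | ∀ j ∈ J, g j ∈ univ.image f} : ℝ) ≤
        (l : ℝ) ^ #J * (n : ℝ) ^ (l - #J) := by
      have := card_embedding_mem_le (univ.image f) J
      rw [Finset.card_image_of_injective _ f.injective, Finset.card_univ, Fintype.card_fin] at this
      exact_mod_cast this
    calc _ ≤ (l : ℝ) ^ #J * (n : ℝ) ^ (l - #J) * p ^ (2 * l - #J) := by gcongr
      _ = (l : ℝ) ^ #J * (p ^ l * (n * p) ^ (l - #J)) := by
          rw [show 2 * l - #J = l + (l - #J) by omega, pow_add, mul_pow]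
          ring
      _ ≤ _ := by gcongr
  rw [erVar_eq, erExp_cycleCopies_sq, erExp_cycleCopies]
  calc _ ≤ (∑ f : Fin l ↪ Fin n, ∑ g : Fin l ↪ Fin n, (p ^ (2 * l) +
        ∑ J : Finset (Fin l) with J.Nonempty,
          if ∀ j ∈ J, g j ∈ univ.image f then p ^ (2 * l - #J) else 0)) -
        (n.descFactorial l * p ^ l) ^ 2 := by
        gcongr with f _ g _
        exact pow_card_union_cycleEdges_le hp0 hp1 f g
    _ = ∑ f : Fin l ↪ Fin n, ∑ J : Finset (Fin l) with J.Nonempty, ∑ g : Fin l ↪ Fin n,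
          if ∀ j ∈ J, g j ∈ univ.image f then p ^ (2 * l - #J) else 0 := by
        simp only [Finset.sum_add_distrib, Finset.sum_const, Finset.card_univ, nsmul_eq_mul,
          hcardE]
        rw [add_sub_assoc, add_comm, sub_add_eq_add_sub, add_sub_assoc,
          show (n.descFactorial l : ℝ) * (n.descFactorial l * p ^ (2 * l)) -
            (n.descFactorial l * p ^ l) ^ 2 = 0 by ring, add_zero]
        exact Finset.sum_congr rfl fun f _ => Finset.sum_comm
    _ ≤ ∑ f : Fin l ↪ Fin n, ∑ J : Finset (Fin l) with J.Nonempty,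
          (l : ℝ) ^ l * (p ^ l * (n * p) ^ (l - 1)) :=
        Finset.sum_le_sum fun f _ => Finset.sum_le_sum fun J hJ =>
          hterm f J (Finset.mem_filter.1 hJ).2
    _ = n.descFactorial l * (#{J : Finset (Fin l) | J.Nonempty} *
          ((l : ℝ) ^ l * (p ^ l * (n * p) ^ (l - 1)))) := by
        simp only [Finset.sum_const, Finset.card_univ, nsmul_eq_mul, hcardE]
    _ ≤ (n : ℝ) ^ l * ((2 : ℝ) ^ l * ((l : ℝ) ^ l * (p ^ l * (n * p) ^ (l - 1)))) := by
        gcongr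
        · exact_mod_cast Nat.descFactorial_le_pow n l
        · have := Finset.card_le_univ ({J : Finset (Fin l) | J.Nonempty} : Finset _)
          rw [Fintype.card_finset, Fintype.card_fin] at this
          exact_mod_cast this
    _ = _ := by
        rw [show 2 * l - 1 = l + (l - 1) by omega, pow_add (n * p) l,
          mul_pow (n : ℝ) p l, mul_pow]
        ring

theorem expCycles_eq (n : ℕ) (p : ℝ) (m : ℕ) :
    expCycles n p (m + 3) = erExp n p (cycleCopies m) / (2 * (m + 3 : ℕ)) := by
  rw [expCycles, erExp_cycleCopies, Nat.descFactorial_eq_factorial_mul_choose,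
    show m + 3 - 1 = m + 2 from rfl, Nat.factorial_succ (m + 2)]
  push_cast
  field_simp
  ring

theorem half_pow_le_descFactorial {n l : ℕ} (h : 2 * l ≤ n) :
    ((n : ℝ) / 2) ^ l ≤ n.descFactorial l := by
  have h1 : ((n + 1 - l : ℕ) : ℝ) ^ l ≤ n.descFactorial l := by
    exact_mod_cast Nat.pow_sub_le_descFactorial n l
  refine le_trans (pow_le_pow_left₀ (by positivity) ?_ l) h1
  rw [Nat.cast_sub (by omega)]
  have : (2 * l : ℝ) ≤ n := by exact_mod_cast h
  push_cast
  linarith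

/-- The lower tail of the number of cycles, by the second moment method. -/
theorem erProb_numCycles_lt_le {m n : ℕ} {p : ℝ} (hp0 : 0 ≤ p) (hp1 : p ≤ 1)
    (hnp : 1 ≤ n * p) (hn : 2 * (m + 3) ≤ n) :
    erProb n p {G | (numCycles G (m + 3) : ℝ) < expCycles n p (m + 3) / 2} ≤
      4 * (8 * (m + 3 : ℕ)) ^ (m + 3) / (n * p) := by
  have hx : (0 : ℝ) < n * p := by linarith
  have hmean : (n * p / 2) ^ (m + 3) ≤ erExp n p (cycleCopies m) := by
    rw [erExp_cycleCopies, mul_div_right_comm, mul_pow]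
    exact mul_le_mul_of_nonneg_right (half_pow_le_descFactorial hn) (by positivity)
  have hpos : 0 < erExp n p (cycleCopies m) := lt_of_lt_of_le (by positivity) hmean
  calc _ ≤ erProb n p {G | cycleCopies m G < erExp n p (cycleCopies m) / 2} := by
        refine Finset.sum_le_sum fun G _ => Set.indicator_le_indicator_of_subset ?_
          (graphWeight_nonneg hp0 hp1) G
        intro G hG
        simp only [Set.mem_ofPred_eq, expCycles_eq] at hG ⊢
        refine (cycleCopies_le_mul_numCycles m G).trans_lt ?_
        rw [div_div, mul_comm (2 * ((m + 3 : ℕ) : ℝ)) 2, ← div_div,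
          lt_div_iff₀ (by positivity)] at hG
        rwa [mul_comm]
    _ ≤ 4 * erVar n p (cycleCopies m) / erExp n p (cycleCopies m) ^ 2 :=
        erProb_lt_half_le hp0 hp1 _ hpos
    _ ≤ 4 * ((2 * (m + 3 : ℕ)) ^ (m + 3) * (n * p) ^ (2 * (m + 3) - 1)) /
          ((n * p / 2) ^ (m + 3)) ^ 2 := by
        gcongr
        exact erVar_cycleCopies_le hp0 hp1 hnp
    _ = _ := by
        rw [div_eq_div_iff (by positivity) hx.ne', show (8 : ℝ) = 2 * 2 ^ 2 by norm_num]
        simp only [mul_pow, div_pow, ← pow_mul]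
        rw [show 2 * (m + 3) - 1 = 2 * m + 5 by omega]
        field_simp
        ring

/-- The upper tail of the number of cycles, by the first moment method. -/
theorem erProb_lt_numCycles_le {m n : ℕ} {p t : ℝ} (hp0 : 0 ≤ p) (hp1 : p ≤ 1) (ht : 0 < t) :
    erProb n p {G | t < (numCycles G (m + 3) : ℝ)} ≤ (n * p) ^ (m + 3) / t := by
  have := erProb_le_of_one_le (n := n) hp0 hp1 (B := {G | t < (numCycles G (m + 3) : ℝ)})
    (X := fun G => t⁻¹ * cycleCopies m G)
    (fun G => mul_nonneg (by positivity) (cycleCopies_nonneg m G)) (fun G hG => by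
      simp only [Set.mem_ofPred_eq] at hG
      rw [inv_mul_eq_div, one_le_div ht]
      exact hG.le.trans (numCycles_le_cycleCopies m G))
  refine this.trans ?_
  rw [erExp_const_mul, erExp_cycleCopies, inv_mul_eq_div, mul_pow]
  gcongr
  exact_mod_cast Nat.descFactorial_le_pow n (m + 3)

theorem erProb_le_sum_add {n : ℕ} {p : ℝ} (hp0 : 0 ≤ p) (hp1 : p ≤ 1) {ι : Type*}
    (s : Finset ι) {B : Set (SimpleGraph (Fin n))} (L U : ι → Set (SimpleGraph (Fin n)))
    (h : ∀ G ∈ B, ∃ i ∈ s, G ∈ L i ∨ G ∈ U i) :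
    erProb n p B ≤ ∑ i ∈ s, (erProb n p (L i) + erProb n p (U i)) := by
  simp only [erProb, ← Finset.sum_add_distrib]
  rw [Finset.sum_comm]
  refine Finset.sum_le_sum fun G _ => ?_
  have hw := graphWeight_nonneg hp0 hp1 (n := n)
  have hnn : ∀ C : Set (SimpleGraph (Fin n)), 0 ≤ C.indicator (graphWeight n p) G :=
    fun C => Set.indicator_nonneg (fun G _ => hw G) G
  by_cases hG : G ∈ B
  · obtain ⟨i, hi, hLU⟩ := h G hG
    refine le_trans ?_ (Finset.single_le_sum (fun i _ => add_nonneg (hnn (L i)) (hnn (U i))) hi)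
    rw [Set.indicator_of_mem hG]
    obtain hL | hU := hLU
    · rw [Set.indicator_of_mem hL]
      exact le_add_of_nonneg_right (hnn _)
    · rw [Set.indicator_of_mem hU]
      exact le_add_of_nonneg_left (hnn _)
  · rw [Set.indicator_of_notMem hG]
    exact Finset.sum_nonneg fun i _ => add_nonneg (hnn _) (hnn _)

/-- The exponent of `n` in `E(X_ℓ)` is strictly smaller than in the upper threshold. -/
theorem mul_one_sub_lt_exponent {β : ℝ} (hβ0 : 0 < β) (hβ1 : β < 1) (m : ℕ) :
    (1 - β) * (m + 3 : ℕ) <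
      (2 - β) * (((m + 3 + 1) / 2 : ℕ) - min (1 / 2) (β / (2 - β))) := by
  have h1 := min_le_left (1 / 2) (β / (2 - β))
  have h2 : min (1 / 2) (β / (2 - β)) * (2 - β) ≤ β := by
    rw [← le_div_iff₀ (by linarith)]
    exact min_le_right _ _
  set α := min (1 / 2) (β / (2 - β))
  obtain ⟨c, rfl | rfl⟩ := m.even_or_odd'
  · rw [show (2 * c + 3 + 1) / 2 = c + 2 by omega]
    have hc : (0 : ℝ) ≤ c := c.cast_nonneg
    push_cast
    nlinarith [mul_nonneg hβ0.le hc]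
  · rw [show (2 * c + 1 + 3 + 1) / 2 = c + 2 by omega]
    have hc : (0 : ℝ) ≤ c := c.cast_nonneg
    push_cast
    nlinarith [mul_nonneg hβ0.le hc]

theorem natCast_mul_rpow_neg {β : ℝ} {n : ℕ} (hn : 0 < n) :
    (n : ℝ) * (n : ℝ) ^ (-β) = (n : ℝ) ^ (1 - β) := by
  rw [sub_eq_add_neg, Real.rpow_add (by exact_mod_cast hn), Real.rpow_one]

theorem rpow_div_four_le_expEdges {β : ℝ} {n : ℕ} (hn : 2 ≤ n) :
    (n : ℝ) ^ (2 - β) / 4 ≤ expEdges n ((n : ℝ) ^ (-β)) := by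
  have hn' : (2 : ℝ) ≤ n := by exact_mod_cast hn
  rw [expEdges, Nat.cast_choose_two, sub_eq_add_neg, Real.rpow_add (by linarith), Real.rpow_two,
    mul_div_right_comm]
  exact mul_le_mul_of_nonneg_right (by nlinarith) (by positivity)

theorem tendsto_erProb_numCycles_lt {β : ℝ} (hβ0 : 0 < β) (hβ1 : β < 1) (m : ℕ) :
    Tendsto (fun n : ℕ => erProb n ((n : ℝ) ^ (-β))
      {G | (numCycles G (m + 3) : ℝ) < expCycles n ((n : ℝ) ^ (-β)) (m + 3) / 2})
      atTop (nhds 0) := by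
  have hlim : Tendsto (fun n : ℕ => 4 * (8 * (m + 3 : ℕ)) ^ (m + 3) / (n : ℝ) ^ (1 - β))
      atTop (nhds 0) :=
    ((tendsto_rpow_atTop (by linarith)).comp tendsto_natCast_atTop_atTop).const_div_atTop _
  refine tendsto_of_tendsto_of_tendsto_of_le_of_le' tendsto_const_nhds hlim ?_ ?_
  · filter_upwards [eventually_ge_atTop 1] with n hn
    exact erProb_nonneg (by positivity)
      (Real.rpow_le_one_of_one_le_of_nonpos (by exact_mod_cast hn) (by linarith)) _
  · filter_upwards [eventually_ge_atTop (2 * (m + 3))] with n hn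
    have hn1 : (1 : ℝ) ≤ n := by exact_mod_cast (by omega : 1 ≤ n)
    rw [← natCast_mul_rpow_neg (by omega)]
    refine erProb_numCycles_lt_le (by positivity)
      (Real.rpow_le_one_of_one_le_of_nonpos hn1 (by linarith)) ?_ hn
    rw [natCast_mul_rpow_neg (by omega)]
    exact Real.one_le_rpow hn1 (by linarith)

theorem tendsto_erProb_lt_numCycles {β γ A : ℝ} (hβ0 : 0 < β) (hA : 0 < A) (m : ℕ)
    (hγ0 : 0 ≤ γ) (hγ : (1 - β) * (m + 3 : ℕ) < (2 - β) * γ) :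
    Tendsto (fun n : ℕ => erProb n ((n : ℝ) ^ (-β))
      {G | A * expEdges n ((n : ℝ) ^ (-β)) ^ γ < (numCycles G (m + 3) : ℝ)})
      atTop (nhds 0) := by
  have hlim : Tendsto (fun n : ℕ => 4 ^ γ / A / (n : ℝ) ^ ((2 - β) * γ - (1 - β) * (m + 3 : ℕ)))
      atTop (nhds 0) :=
    ((tendsto_rpow_atTop (by linarith)).comp tendsto_natCast_atTop_atTop).const_div_atTop _
  refine tendsto_of_tendsto_of_tendsto_of_le_of_le' tendsto_const_nhds hlim ?_ ?_
  · filter_upwards [eventually_ge_atTop 1] with n hn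
    exact erProb_nonneg (by positivity)
      (Real.rpow_le_one_of_one_le_of_nonpos (by exact_mod_cast hn) (by linarith)) _
  · filter_upwards [eventually_ge_atTop 2] with n hn
    have hn1 : (1 : ℝ) ≤ n := by exact_mod_cast (by omega : 1 ≤ n)
    have hn0 : (0 : ℝ) < n := by linarith
    have hE := rpow_div_four_le_expEdges (β := β) hn
    have hE0 : 0 < expEdges n ((n : ℝ) ^ (-β)) := lt_of_lt_of_le (by positivity) hE
    calc _ ≤ (n * (n : ℝ) ^ (-β)) ^ (m + 3) / (A * expEdges n ((n : ℝ) ^ (-β)) ^ γ) :=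
          erProb_lt_numCycles_le (by positivity)
            (Real.rpow_le_one_of_one_le_of_nonpos hn1 (by linarith)) (by positivity)
      _ ≤ (n : ℝ) ^ ((1 - β) * (m + 3 : ℕ)) / (A * ((n : ℝ) ^ (2 - β) / 4) ^ γ) := by
          rw [natCast_mul_rpow_neg (by omega), ← Real.rpow_natCast, ← Real.rpow_mul hn0.le]
          gcongr
      _ = _ := by
          rw [Real.div_rpow (by positivity) (by norm_num), ← Real.rpow_mul hn0.le,
            Real.rpow_sub hn0]
          field_simp

open Filter in
theorem stmt14 (β : ℝ) (hβ0 : 0 < β) (hβ1 : β < 1) (k : ℕ) (hk : 3 ≤ k) :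
    ∃ A₀ > (0 : ℝ), ∀ A ≥ A₀,
      Tendsto (fun n => erProb n ((n : ℝ) ^ (-β))
          {G | ∀ ℓ, 3 ≤ ℓ → ℓ ≤ k →
            expCycles n ((n : ℝ) ^ (-β)) ℓ / 2 ≤ (numCycles G ℓ : ℝ) ∧
              (numCycles G ℓ : ℝ) ≤
                A * (expEdges n ((n : ℝ) ^ (-β))) ^
                  ((((ℓ + 1) / 2 : ℕ) : ℝ) - min (1 / 2) (β / (2 - β)))})
        atTop (nhds 1) := by
  refine ⟨1, one_pos, fun A hA => ?_⟩
  simp only [erProb_eq_one_sub_compl _ _ {G | ∀ ℓ, _}]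
  suffices h : Tendsto (fun n => erProb n ((n : ℝ) ^ (-β)) {G | ∀ ℓ, 3 ≤ ℓ → ℓ ≤ k →
      expCycles n ((n : ℝ) ^ (-β)) ℓ / 2 ≤ (numCycles G ℓ : ℝ) ∧
        (numCycles G ℓ : ℝ) ≤ A * (expEdges n ((n : ℝ) ^ (-β))) ^
          ((((ℓ + 1) / 2 : ℕ) : ℝ) - min (1 / 2) (β / (2 - β)))}ᶜ) atTop (nhds 0) by
    simpa only [sub_zero] using h.const_sub 1
  set L : (n : ℕ) → ℕ → Set (SimpleGraph (Fin n)) := fun n m =>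
    {G | (numCycles G (m + 3) : ℝ) < expCycles n ((n : ℝ) ^ (-β)) (m + 3) / 2}
  set U : (n : ℕ) → ℕ → Set (SimpleGraph (Fin n)) := fun n m =>
    {G | A * expEdges n ((n : ℝ) ^ (-β)) ^
      ((((m + 3 + 1) / 2 : ℕ) : ℝ) - min (1 / 2) (β / (2 - β))) <
        (numCycles G (m + 3) : ℝ)}
  have hlim : Tendsto (fun n : ℕ => ∑ m ∈ Finset.range (k - 2),
      (erProb n ((n : ℝ) ^ (-β)) (L n m) + erProb n ((n : ℝ) ^ (-β)) (U n m)))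
      atTop (nhds 0) := by
    rw [← Finset.sum_const_zero (s := Finset.range (k - 2)) (M := ℝ)]
    refine tendsto_finsetSum _ fun m _ => ?_
    rw [← add_zero (0 : ℝ)]
    have hexp := mul_one_sub_lt_exponent hβ0 hβ1 m
    refine (tendsto_erProb_numCycles_lt hβ0 hβ1 m).add
      (tendsto_erProb_lt_numCycles hβ0 (by linarith) m ?_ hexp)
    have h0 : 0 ≤ (1 - β) * (m + 3 : ℕ) := mul_nonneg (by linarith) (by positivity)
    exact (pos_of_mul_pos_right (h0.trans_lt hexp) (by linarith)).le
  refine tendsto_of_tendsto_of_tendsto_of_le_of_le' tendsto_const_nhds hlim ?_ ?_ <;>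
    filter_upwards [eventually_ge_atTop 1] with n hn
  all_goals
    have hp0 : 0 ≤ (n : ℝ) ^ (-β) := by positivity
    have hp1 : (n : ℝ) ^ (-β) ≤ 1 :=
      Real.rpow_le_one_of_one_le_of_nonpos (by exact_mod_cast hn) (by linarith)
  · exact erProb_nonneg hp0 hp1 _
  · refine erProb_le_sum_add hp0 hp1 _ (L n) (U n) fun G hG => ?_
    simp only [Set.mem_compl_iff, Set.mem_ofPred_eq, not_forall, not_and_or, not_le] at hG
    obtain ⟨l, hl3, hlk, h⟩ := hG
    obtain ⟨m, rfl⟩ := Nat.exists_eq_add_of_le' hl3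
    exact ⟨m, Finset.mem_range.2 (by omega), h⟩

end SEP
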